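/- For every j = (j₁,j₂,j₃) ∈ ℤ³ with β_{j₁,j₂} ≠ j₃π/c̃ and β_{j₁,j₂} ≠ −j₃π/c̃, the Fourier coefficient of K_d satisfies K̂_{dj} = (1/√(8π²c̃)) · [ 1/((α₁+j₁)² + (α₂+j₂)² + (j₃π/c̃)² − k²) + (1/(2β_{j₁,j₂}(j₃π/c̃ − β_{j₁,j₂}))) ∫₀^{c̃} e^{i(β_{j₁,j₂} − j₃π/c̃) x₃} 𝒳′(x₃) dx₃ − (1/(2β_{j₁,j₂}(j₃π/c̃ + β_{j₁,j₂}))) ∫₀^{c̃} e^{i(β_{j₁,j₂} + j₃π/c̃) x₃} 𝒳′(x₃) dx₃ ]. -/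

import Mathlib

open MeasureTheory Complex Real

noncomputable section

/-- β_{n₁,n₂} from the eigenfunction expansion of the 3D doubly quasi-periodic
Green's function. -/
def betaCoef3 (k α₁ α₂ : ℝ) (n : ℤ × ℤ) : ℂ :=
  if (α₁ + (n.1 : ℝ)) ^ 2 + (α₂ + (n.2 : ℝ)) ^ 2 ≤ k ^ 2 then
    ((Real.sqrt (k ^ 2 - (α₁ + (n.1 : ℝ)) ^ 2 - (α₂ + (n.2 : ℝ)) ^ 2) : ℝ) : ℂ)
  else Complex.I * ((Real.sqrt ((α₁ + (n.1 : ℝ)) ^ 2 + (α₂ + (n.2 : ℝ)) ^ 2 - k ^ 2) : ℝ) : ℂ)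

/-- The doubly quasi-periodic Green's function (eigenfunction expansion). -/
def greenGd (k α₁ α₂ : ℝ) (x : EuclideanSpace ℝ (Fin 3)) : ℂ :=
  (Complex.I / (8 * (π : ℂ) ^ 2)) *
    ∑' n : ℤ × ℤ, (1 / betaCoef3 k α₁ α₂ n) *
      Complex.exp (Complex.I * ((α₁ + (n.1 : ℝ) : ℝ) : ℂ) * (x 0 : ℂ) +
        Complex.I * ((α₂ + (n.2 : ℝ) : ℝ) : ℂ) * (x 1 : ℂ) +
        Complex.I * betaCoef3 k α₁ α₂ n * ((|x 2| : ℝ) : ℂ))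

/-- K_d(x) = e^{−iα₁x₁−iα₂x₂} G_d(x) 𝒳(|x₃|). -/
def funKd (k α₁ α₂ : ℝ) (𝒳 : ℝ → ℝ) (x : EuclideanSpace ℝ (Fin 3)) : ℂ :=
  Complex.exp (-Complex.I * (α₁ : ℂ) * (x 0 : ℂ) - Complex.I * (α₂ : ℂ) * (x 1 : ℂ)) *
    greenGd k α₁ α₂ x * ((𝒳 |x 2| : ℝ) : ℂ)

/-- The box D_{dc̃} = [−π,π]² × [−c̃,c̃]. -/
def domDd (ct : ℝ) : Set (EuclideanSpace ℝ (Fin 3)) :=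
  {x | x 0 ∈ Set.Icc (-π) π ∧ x 1 ∈ Set.Icc (-π) π ∧ x 2 ∈ Set.Icc (-ct) ct}

/-- The Fourier basis φ_j(x) = (1/√(8π²c̃)) e^{i(j₁x₁ + j₂x₂ + j₃πx₃/c̃)}. -/
def fBasis3 (ct : ℝ) (j : ℤ × ℤ × ℤ) (x : EuclideanSpace ℝ (Fin 3)) : ℂ :=
  (1 / Real.sqrt (8 * π ^ 2 * ct) : ℝ) *
    Complex.exp (Complex.I * ((j.1 : ℂ) * (x 0 : ℂ) + (j.2.1 : ℂ) * (x 1 : ℂ) +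
      (j.2.2 : ℂ) * (π : ℂ) * (x 2 : ℂ) / (ct : ℂ)))

/-- The j-th Fourier coefficient ĝ_j = ∫_{D_{dc̃}} g(x) φ_{−j}(x) dx. -/
def fourierCoef3 (ct : ℝ) (g : EuclideanSpace ℝ (Fin 3) → ℂ) (j : ℤ × ℤ × ℤ) : ℂ :=
  ∫ x in domDd ct, g x * fBasis3 ct (-j) x

/-- The plane wave `y ↦ exp (i n·y)` on `ℝ × ℝ` with integer frequency `n`. -/
def planeWave (n : ℤ × ℤ) (y : ℝ × ℝ) : ℂ :=
  Complex.exp (Complex.I * ((n.1 : ℂ) * (y.1 : ℂ) + (n.2 : ℂ) * (y.2 : ℂ)))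

/-- Lebesgue measure on the period cell `[-π, π]²`. -/
def cellMeasure : Measure (ℝ × ℝ) :=
  (volume.restrict (Set.Icc (-π) π)).prod (volume.restrict (Set.Icc (-π) π))

instance : IsFiniteMeasure cellMeasure := by
  unfold cellMeasure; infer_instance

lemma continuous_planeWave (n : ℤ × ℤ) : Continuous (planeWave n) := by
  unfold planeWave; fun_prop

lemma norm_planeWave (n : ℤ × ℤ) (y : ℝ × ℝ) : ‖planeWave n y‖ = 1 := by
  have : planeWave n y = Complex.exp (((n.1 * y.1 + n.2 * y.2 : ℝ) : ℂ) * Complex.I) := by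
    unfold planeWave; push_cast; ring_nf
  rw [this, Complex.norm_exp_ofReal_mul_I]

lemma planeWave_mul (n m : ℤ × ℤ) (y : ℝ × ℝ) :
    planeWave n y * planeWave m y = planeWave (n + m) y := by
  simp only [planeWave, ← Complex.exp_add, Prod.fst_add, Prod.snd_add]
  push_cast; ring_nf

lemma conj_planeWave (n : ℤ × ℤ) (y : ℝ × ℝ) :
    (starRingEnd ℂ) (planeWave n y) = planeWave (-n) y := by
  simp [planeWave, ← Complex.exp_conj, mul_add]

lemma integrable_planeWave (n : ℤ × ℤ) : Integrable (planeWave n) cellMeasure :=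
  (integrable_const (1 : ℝ)).mono' (continuous_planeWave n).aestronglyMeasurable
    (.of_forall fun y => (norm_planeWave n y).le)

lemma integral_exp_int_mul (m : ℤ) :
    ∫ x in Set.Icc (-π) π, Complex.exp (Complex.I * ((m : ℂ) * (x : ℂ))) =
      if m = 0 then 2 * (π : ℂ) else 0 := by
  rw [integral_Icc_eq_integral_Ioc, ← intervalIntegral.integral_of_le (by linarith [pi_pos])]
  split_ifs with h
  · simp [h]; ring
  · have hm : Complex.I * (m : ℂ) ≠ 0 := by simp [h]
    simp_rw [← mul_assoc]
    rw [integral_exp_mul_complex hm]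
    have : Complex.exp (Complex.I * m * (π : ℝ)) = Complex.exp (Complex.I * m * ((-π : ℝ) : ℂ)) := by
      rw [Complex.exp_eq_exp_iff_exists_int]
      exact ⟨m, by push_cast; ring⟩
    rw [this]; simp

lemma integral_planeWave (n : ℤ × ℤ) :
    ∫ y, planeWave n y ∂cellMeasure = if n = 0 then (2 * (π : ℂ)) ^ 2 else 0 := by
  have : planeWave n = fun y : ℝ × ℝ => Complex.exp (Complex.I * ((n.1 : ℂ) * (y.1 : ℂ))) *
      Complex.exp (Complex.I * ((n.2 : ℂ) * (y.2 : ℂ))) := by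
    ext y; rw [← Complex.exp_add, ← mul_add]; rfl
  rw [this, cellMeasure, integral_prod_mul
    (fun x : ℝ => Complex.exp (Complex.I * ((n.1 : ℂ) * (x : ℂ))))
    (fun x : ℝ => Complex.exp (Complex.I * ((n.2 : ℂ) * (x : ℂ)))),
    integral_exp_int_mul, integral_exp_int_mul]
  rcases n with ⟨p, q⟩
  by_cases hp : p = 0 <;> by_cases hq : q = 0 <;> simp [hp, hq, sq]

section PlaneWaveSeries

variable {a : ℤ × ℤ → ℂ}

lemma summable_planeWave (ha : Summable fun n => ‖a n‖) (y : ℝ × ℝ) :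
    Summable fun n => ‖a n * planeWave n y‖ := by
  simpa [norm_planeWave] using ha

lemma norm_tsum_planeWave_le (ha : Summable fun n => ‖a n‖) (y : ℝ × ℝ) :
    ‖∑' n, a n * planeWave n y‖ ≤ ∑' n, ‖a n‖ := by
  simpa [norm_planeWave] using norm_tsum_le_tsum_norm (summable_planeWave ha y)

lemma integrable_tsum_planeWave (ha : Summable fun n => ‖a n‖) :
    Integrable (fun y => ∑' n, a n * planeWave n y) cellMeasure :=
  (integrable_const (∑' n, ‖a n‖)).mono'
    (AEStronglyMeasurable.tsum fun n =>
      ((continuous_planeWave n).const_mul (a n)).aestronglyMeasurable)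
    (.of_forall fun y => norm_tsum_planeWave_le ha y)

/-- Termwise integration of an absolutely convergent series of plane waves against a bounded
function. -/
lemma hasSum_integral_tsum_planeWave_mul (ha : Summable fun n => ‖a n‖) {h : ℝ × ℝ → ℂ} {C : ℝ}
    (hm : AEStronglyMeasurable h cellMeasure) (hC : ∀ y, ‖h y‖ ≤ C) :
    HasSum (fun n => a n * ∫ y, planeWave n y * h y ∂cellMeasure)
      (∫ y, (∑' n, a n * planeWave n y) * h y ∂cellMeasure) := by
  have hint : ∀ n, Integrable (fun y => a n * planeWave n y * h y) cellMeasure := fun n =>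
    ((integrable_planeWave n).const_mul (a n)).mul_bdd hm (.of_forall hC)
  have key := hasSum_integral_of_summable_integral_norm hint (by
    refine Summable.of_nonneg_of_le (fun n => by positivity) (fun n => ?_)
      (ha.mul_right (∫ _, C ∂cellMeasure))
    rw [← integral_const_mul]
    refine integral_mono (hint n).norm (by fun_prop) fun y => ?_
    simp only [norm_mul, norm_planeWave, mul_one]
    exact mul_le_mul_of_nonneg_left (hC y) (norm_nonneg _))
  simp_rw [tsum_mul_right, mul_assoc, integral_const_mul] at key
  exact key

/-- The Fourier coefficients of an absolutely convergent series of plane waves. -/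
lemma integral_tsum_planeWave_mul (ha : Summable fun n => ‖a n‖) (m : ℤ × ℤ) :
    ∫ y, (∑' n, a n * planeWave n y) * planeWave (-m) y ∂cellMeasure = (2 * (π : ℂ)) ^ 2 * a m := by
  have key := hasSum_integral_tsum_planeWave_mul ha
    (continuous_planeWave (-m)).aestronglyMeasurable fun y => (norm_planeWave (-m) y).le
  rw [← key.tsum_eq, tsum_eq_single m]
  · simp [planeWave_mul, integral_planeWave, mul_comm]
  · intro n hn
    simp [planeWave_mul, integral_planeWave, add_neg_eq_zero, hn]

/-- Parseval's identity for an absolutely convergent series of plane waves. -/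
lemma hasSum_norm_sq_planeWave (ha : Summable fun n => ‖a n‖) :
    HasSum (fun n => (2 * π) ^ 2 * ‖a n‖ ^ 2)
      (∫ y, ‖∑' n, a n * planeWave n y‖ ^ 2 ∂cellMeasure) := by
  have hg := integrable_tsum_planeWave ha
  have key := hasSum_integral_tsum_planeWave_mul ha (hg.1.star)
    (C := ∑' n, ‖a n‖) fun y => by simpa using norm_tsum_planeWave_le ha y
  rw [← Complex.hasSum_ofReal]
  convert! key using 1
  · ext n
    have h := congrArg (starRingEnd ℂ) (integral_tsum_planeWave_mul ha n)
    rw [← integral_conj] at h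
    simp only [map_mul, conj_planeWave, neg_neg] at h
    simp only [Pi.star_apply, RCLike.star_def]
    simp_rw [mul_comm (planeWave n _), h]
    simp only [map_pow, map_mul, Complex.conj_ofReal, Complex.conj_ofNat]
    rw [mul_left_comm, Complex.mul_conj']
    push_cast; rfl
  · rw [← integral_complex_ofReal]
    refine integral_congr_ae (.of_forall fun y => ?_)
    simp [Complex.mul_conj']

/-- The `L¹` norm of an absolutely convergent series of plane waves is controlled by the `ℓ²` norm
of its coefficients. -/
lemma integral_norm_tsum_planeWave_le (ha : Summable fun n => ‖a n‖) :
    ∫ y, ‖∑' n, a n * planeWave n y‖ ∂cellMeasure ≤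
      cellMeasure.real Set.univ + (2 * π) ^ 2 * ∑' n, ‖a n‖ ^ 2 := by
  have hg := integrable_tsum_planeWave ha
  have hg2 : Integrable (fun y => ‖∑' n, a n * planeWave n y‖ ^ 2) cellMeasure :=
    (integrable_const ((∑' n, ‖a n‖) ^ 2)).mono' (hg.1.norm.pow 2) (.of_forall fun y => by
      rw [Real.norm_of_nonneg (by positivity)]
      exact pow_le_pow_left₀ (norm_nonneg _) (norm_tsum_planeWave_le ha y) 2)
  rw [← tsum_mul_left, (hasSum_norm_sq_planeWave ha).tsum_eq]
  calc _ ≤ ∫ y, (1 + ‖∑' n, a n * planeWave n y‖ ^ 2) ∂cellMeasure :=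
        integral_mono hg.norm ((integrable_const _).add hg2) fun y => by
          dsimp only; nlinarith [sq_nonneg (‖∑' n, a n * planeWave n y‖ - 1)]
    _ = _ := by rw [integral_add (integrable_const _) hg2]; simp

end PlaneWaveSeries

section ProductIntegral

variable {μ : Measure ℝ} [IsFiniteMeasure μ] {a : ℤ × ℤ → ℝ → ℂ} {h : ℝ → ℂ} {C : ℝ}

/-- A series of plane waves whose coefficients depend on a parameter is integrable on the product
space as soon as the sum of the squares of the coefficients is integrable. -/
lemma integrable_prod_tsum_planeWave (ham : ∀ n, Measurable (a n))
    (has : ∀ᵐ t ∂μ, Summable fun n => ‖a n t‖)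
    (ha2 : Integrable (fun t => ∑' n, ‖a n t‖ ^ 2) μ) :
    Integrable (fun p : ℝ × ℝ × ℝ => ∑' n, a n p.1 * planeWave n p.2) (μ.prod cellMeasure) := by
  have hm : AEStronglyMeasurable (fun p : ℝ × ℝ × ℝ => ∑' n, a n p.1 * planeWave n p.2)
      (μ.prod cellMeasure) :=
    AEStronglyMeasurable.tsum fun n => (((ham n).comp measurable_fst).mul
      ((continuous_planeWave n).measurable.comp measurable_snd)).aestronglyMeasurable
  rw [integrable_prod_iff hm]
  refine ⟨has.mono fun t ht => integrable_tsum_planeWave ht, ?_⟩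
  refine ((integrable_const (cellMeasure.real Set.univ)).add (ha2.const_mul ((2 * π) ^ 2))).mono'
    hm.norm.integral_prod_right' (has.mono fun t ht => ?_)
  rw [Real.norm_of_nonneg (integral_nonneg fun _ => norm_nonneg _)]
  exact integral_norm_tsum_planeWave_le ht

/-- Integrating a parameter-dependent series of plane waves against a single plane wave and a bounded
function of the parameter extracts one coefficient. -/
lemma integral_prod_tsum_planeWave (ham : ∀ n, Measurable (a n))
    (has : ∀ᵐ t ∂μ, Summable fun n => ‖a n t‖)
    (ha2 : Integrable (fun t => ∑' n, ‖a n t‖ ^ 2) μ)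
    (hm : Measurable h) (hC : ∀ t, ‖h t‖ ≤ C) (m : ℤ × ℤ) :
    ∫ p : ℝ × ℝ × ℝ, (∑' n, a n p.1 * planeWave n p.2) * (h p.1 * planeWave (-m) p.2)
        ∂(μ.prod cellMeasure) = (2 * (π : ℂ)) ^ 2 * ∫ t, h t * a m t ∂μ := by
  have hint : Integrable (fun p : ℝ × ℝ × ℝ =>
      (∑' n, a n p.1 * planeWave n p.2) * (h p.1 * planeWave (-m) p.2)) (μ.prod cellMeasure) :=
    (integrable_prod_tsum_planeWave ham has ha2).mul_bdd (c := C)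
      ((hm.comp measurable_fst).mul
        ((continuous_planeWave (-m)).measurable.comp measurable_snd)).aestronglyMeasurable
      (.of_forall fun p => by simpa [norm_planeWave] using hC p.1)
  rw [integral_prod _ hint, ← integral_const_mul]
  refine integral_congr_ae (has.mono fun t ht => ?_)
  simp_rw [mul_left_comm _ (h t)]
  rw [integral_const_mul, integral_tsum_planeWave_mul ht, mul_left_comm]

end ProductIntegral

/-- `1 + ‖n‖` raised to a power below `-2` is summable over the lattice `ℤ × ℤ`. -/
lemma summable_one_add_norm_rpow {s : ℝ} (hs : 2 < s) :
    Summable fun n : ℤ × ℤ => (1 + ‖n‖) ^ (-s) := by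
  have h := (finTwoArrowEquiv ℤ).symm.summable_iff.mpr
    (EisensteinSeries.summable_one_div_norm_rpow hs)
  refine Summable.of_norm_bounded_eventually h ?_
  filter_upwards [(Set.finite_singleton (0 : ℤ × ℤ)).compl_mem_cofinite] with n hn
  have hpos : 0 < ‖n‖ := norm_pos_iff.mpr hn
  have hnorm : ‖(finTwoArrowEquiv ℤ).symm n‖ = ‖n‖ := by
    rcases n with ⟨p, q⟩
    simp [Pi.norm_def, Prod.norm_def, Finset.univ_fin2]
  rw [Real.norm_of_nonneg (by positivity), Function.comp_apply, hnorm]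
  exact Real.rpow_le_rpow_of_nonpos hpos (by linarith) (by linarith)

/-- `|t| ^ r` is integrable near the origin for `r > -1`. -/
lemma integrableOn_abs_rpow {r : ℝ} (hr : -1 < r) {T : ℝ} (hT : 0 ≤ T) :
    IntegrableOn (fun t : ℝ => |t| ^ r) (Set.Icc (-T) T) := by
  rw [integrableOn_Icc_iff_integrableOn_Ioc,
    ← intervalIntegrable_iff_integrableOn_Ioc_of_le (by linarith)]
  refine intervalIntegrable_of_even (fun x => by rw [abs_neg]) fun x hx =>
    (intervalIntegral.intervalIntegrable_rpow' hr).congr fun t ht => ?_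
  rw [Set.uIoc_of_le hx.le] at ht
  simp [abs_of_pos ht.1]

section BetaBounds

variable {k α₁ α₂ : ℝ}

lemma betaCoef3_sq (n : ℤ × ℤ) : betaCoef3 k α₁ α₂ n ^ 2 =
    ((k ^ 2 - (α₁ + (n.1 : ℝ)) ^ 2 - (α₂ + (n.2 : ℝ)) ^ 2 : ℝ) : ℂ) := by
  unfold betaCoef3
  split_ifs with h
  · rw [← Complex.ofReal_pow, Real.sq_sqrt (by linarith)]
  · rw [mul_pow, ← Complex.ofReal_pow, Real.sq_sqrt (by linarith), Complex.I_sq]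
    push_cast; ring

lemma norm_sub_le_betaCoef3_im (hk : 0 < k) (n : ℤ × ℤ) :
    ‖n‖ - (k + |α₁| + |α₂|) ≤ (betaCoef3 k α₁ α₂ n).im := by
  have aux : ∀ p q x y : ℝ, |q| - (k + |p| + |x|) ≤
      (if (p + q) ^ 2 + y ^ 2 ≤ k ^ 2 then 0 else √((p + q) ^ 2 + y ^ 2 - k ^ 2)) := by
    intro p q x y
    have h1 : |q| ≤ |p + q| + |p| := by simpa using abs_sub (p + q) p
    have h2 := abs_nonneg x
    split_ifs with h
    · have : |p + q| ≤ k := abs_le_of_sq_le_sq (by nlinarith [sq_nonneg y]) hk.le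
      linarith
    · rcases le_total |p + q| k with h3 | h3
      · linarith [Real.sqrt_nonneg ((p + q) ^ 2 + y ^ 2 - k ^ 2)]
      · have : |p + q| - k ≤ √((p + q) ^ 2 + y ^ 2 - k ^ 2) := by
          apply Real.le_sqrt_of_sq_le
          nlinarith [sq_abs (p + q), sq_nonneg y]
        linarith
  have him : (betaCoef3 k α₁ α₂ n).im = if (α₁ + (n.1 : ℝ)) ^ 2 + (α₂ + (n.2 : ℝ)) ^ 2 ≤ k ^ 2
      then 0 else √((α₁ + (n.1 : ℝ)) ^ 2 + (α₂ + (n.2 : ℝ)) ^ 2 - k ^ 2) := by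
    unfold betaCoef3
    split_ifs <;> simp
  rw [him, Prod.norm_def, sub_le_iff_le_add]
  refine max_le ?_ ?_ <;> rw [Int.norm_eq_abs]
  · linarith [aux α₁ n.1 α₂ (α₂ + n.2)]
  · have := aux α₂ n.2 α₁ (α₁ + n.1)
    rw [add_comm ((α₂ + (n.2 : ℝ)) ^ 2)] at this
    linarith

lemma one_add_norm_le_betaCoef3 (hk : 0 < k) {b : ℝ} (hb : 0 < b) (n : ℤ × ℤ)
    (hβ : b ≤ ‖betaCoef3 k α₁ α₂ n‖) :
    b * (1 + ‖n‖) ≤ (b + (k + |α₁| + |α₂|) + 1) * ‖betaCoef3 k α₁ α₂ n‖ := by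
  have h1 := (norm_sub_le_betaCoef3_im (α₁ := α₁) (α₂ := α₂) hk n).trans
    ((le_abs_self _).trans (Complex.abs_im_le_norm _))
  have hM : 0 ≤ k + |α₁| + |α₂| := by positivity
  nlinarith [mul_le_mul_of_nonneg_left h1 hb.le, mul_le_mul_of_nonneg_left hβ hM]

/-- The coefficient of the `n`-th plane wave in the expansion of the Green's function, up to a
constant. -/
def greenMode (k α₁ α₂ : ℝ) (n : ℤ × ℤ) (t : ℝ) : ℂ :=
  1 / betaCoef3 k α₁ α₂ n * Complex.exp (Complex.I * betaCoef3 k α₁ α₂ n * ((|t| : ℝ) : ℂ))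

lemma continuous_greenMode (n : ℤ × ℤ) : Continuous (greenMode k α₁ α₂ n) := by
  unfold greenMode; fun_prop

lemma exists_norm_greenMode_le (hk : 0 < k) {b : ℝ} (hb : 0 < b)
    (hβ : ∀ n : ℤ × ℤ, b ≤ ‖betaCoef3 k α₁ α₂ n‖) (T : ℝ) :
    ∃ C : ℝ, 0 ≤ C ∧ ∀ (n : ℤ × ℤ) (t : ℝ), |t| ≤ T →
      ‖greenMode k α₁ α₂ n t‖ ≤ C * ((1 + ‖n‖)⁻¹ * Real.exp (-((1 + ‖n‖) * |t|))) := by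
  set M := k + |α₁| + |α₂| with hM
  have hM0 : 0 < M := by positivity
  refine ⟨(b + M + 1) / b * Real.exp ((M + 1) * T), by positivity, fun n t ht => ?_⟩
  have hβn : 0 < ‖betaCoef3 k α₁ α₂ n‖ := hb.trans_le (hβ n)
  have h1 : ‖betaCoef3 k α₁ α₂ n‖⁻¹ ≤ (b + M + 1) / b * (1 + ‖n‖)⁻¹ := by
    rw [← div_eq_mul_inv, div_div, ← one_div, div_le_div_iff₀ hβn (by positivity), one_mul]
    exact one_add_norm_le_betaCoef3 hk hb n (hβ n)
  have h2 : ‖Complex.exp (Complex.I * betaCoef3 k α₁ α₂ n * ((|t| : ℝ) : ℂ))‖ ≤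
      Real.exp ((M + 1) * T) * Real.exp (-((1 + ‖n‖) * |t|)) := by
    rw [Complex.norm_exp, ← Real.exp_add]
    apply Real.exp_le_exp.mpr
    have h3 := mul_le_mul_of_nonneg_right
      (norm_sub_le_betaCoef3_im (α₁ := α₁) (α₂ := α₂) hk n) (abs_nonneg t)
    rw [← hM] at h3
    have h4 := mul_le_mul_of_nonneg_left ht (by positivity : 0 ≤ M + 1)
    simp only [Complex.mul_re, Complex.mul_im, Complex.I_re, Complex.I_im, Complex.ofReal_re,
      Complex.ofReal_im]
    linarith
  calc ‖greenMode k α₁ α₂ n t‖ = ‖betaCoef3 k α₁ α₂ n‖⁻¹ *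
        ‖Complex.exp (Complex.I * betaCoef3 k α₁ α₂ n * ((|t| : ℝ) : ℂ))‖ := by
          simp [greenMode]
    _ ≤ _ := mul_le_mul h1 h2 (norm_nonneg _) (by positivity)
    _ = _ := by ring

lemma summable_norm_greenMode (hk : 0 < k) {b : ℝ} (hb : 0 < b)
    (hβ : ∀ n : ℤ × ℤ, b ≤ ‖betaCoef3 k α₁ α₂ n‖) {t : ℝ} (ht : t ≠ 0) :
    Summable fun n => ‖greenMode k α₁ α₂ n t‖ := by
  obtain ⟨C, hC, h⟩ := exists_norm_greenMode_le hk hb hβ |t|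
  have ht' : 0 < |t| := abs_pos.mpr ht
  refine Summable.of_nonneg_of_le (fun n => norm_nonneg _) (fun n => ?_)
    ((summable_one_add_norm_rpow (s := 3) (by norm_num)).mul_left (C * (2 / |t| ^ 2)))
  refine (h n t le_rfl).trans ?_
  rw [mul_assoc]
  refine mul_le_mul_of_nonneg_left ?_ hC
  set w := 1 + ‖n‖
  have hw : 0 < w := by positivity
  have hx : 0 < w * |t| := by positivity
  have he : Real.exp (-(w * |t|)) ≤ 2 / (w * |t|) ^ 2 := by
    rw [Real.exp_neg, ← one_div, div_le_div_iff₀ (Real.exp_pos _) (by positivity)]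
    nlinarith [Real.quadratic_le_exp_of_nonneg hx.le]
  calc w⁻¹ * Real.exp (-(w * |t|)) ≤ w⁻¹ * (2 / (w * |t|) ^ 2) := by gcongr
    _ = 2 / |t| ^ 2 * w ^ (-3 : ℝ) := by
      rw [Real.rpow_neg hw.le, show (3 : ℝ) = ((3 : ℕ) : ℝ) by norm_num, Real.rpow_natCast]
      field_simp

lemma integrableOn_tsum_norm_sq_greenMode (hk : 0 < k) {b : ℝ} (hb : 0 < b)
    (hβ : ∀ n : ℤ × ℤ, b ≤ ‖betaCoef3 k α₁ α₂ n‖) {T : ℝ} (hT : 0 ≤ T) :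
    IntegrableOn (fun t => ∑' n, ‖greenMode k α₁ α₂ n t‖ ^ 2) (Set.Icc (-T) T) := by
  obtain ⟨C, hC, h⟩ := exists_norm_greenMode_le hk hb hβ T
  have hsum := summable_one_add_norm_rpow (s := 5 / 2) (by norm_num)
  refine ((integrableOn_abs_rpow (r := -(1 / 2)) (by norm_num) hT).const_mul
    (C ^ 2 * ∑' n : ℤ × ℤ, (1 + ‖n‖) ^ (-(5 / 2) : ℝ))).mono'
    (AEStronglyMeasurable.tsum fun n =>
      ((continuous_greenMode n).norm.pow 2).aestronglyMeasurable) ?_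
  filter_upwards [ae_restrict_mem measurableSet_Icc, Measure.ae_ne _ 0] with t ht ht0
  have ht' : 0 < |t| := abs_pos.mpr ht0
  rw [Real.norm_of_nonneg (tsum_nonneg fun n => by positivity), ← tsum_mul_left, ← tsum_mul_right]
  have hle : ∀ n, ‖greenMode k α₁ α₂ n t‖ ^ 2 ≤
      C ^ 2 * (1 + ‖n‖) ^ (-(5 / 2) : ℝ) * |t| ^ (-(1 / 2) : ℝ) := by
    intro n
    refine (pow_le_pow_left₀ (norm_nonneg _) (h n t (abs_le.mpr ht)) 2).trans ?_
    rw [mul_pow, mul_assoc]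
    refine mul_le_mul_of_nonneg_left ?_ (by positivity)
    set w := 1 + ‖n‖
    have hw : 0 < w := by positivity
    have hx : 0 < w * |t| := by positivity
    have he : Real.exp (-(w * |t|)) ^ 2 ≤ (w * |t|) ^ (-(1 / 2) : ℝ) := by
      rw [Real.rpow_neg hx.le, ← Real.sqrt_eq_rpow, ← Real.exp_nat_mul, ← Real.exp_log
        (inv_pos.mpr (Real.sqrt_pos.mpr hx)), Real.exp_le_exp, Real.log_inv,
        Real.log_sqrt hx.le]
      have := Real.log_le_sub_one_of_pos hx
      push_cast
      linarith
    calc (w⁻¹ * Real.exp (-(w * |t|))) ^ 2 ≤ (w ^ (2 : ℕ))⁻¹ * (w * |t|) ^ (-(1 / 2) : ℝ) := by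
          rw [mul_pow, inv_pow]; gcongr
      _ = w ^ (-(5 / 2) : ℝ) * |t| ^ (-(1 / 2) : ℝ) := by
          rw [Real.mul_rpow hw.le ht'.le, ← Real.rpow_natCast, ← Real.rpow_neg hw.le, ← mul_assoc,
            ← Real.rpow_add hw]
          norm_num
  have hs := (hsum.mul_left (C ^ 2)).mul_right (|t| ^ (-(1 / 2) : ℝ))
  exact (Summable.of_nonneg_of_le (fun n => by positivity) hle hs).tsum_le_tsum hle hs

end BetaBounds

/-- The measurable equivalence `x ↦ (x₃, (x₁, x₂))`. -/
def splitLast : EuclideanSpace ℝ (Fin 3) ≃ᵐ ℝ × ℝ × ℝ :=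
  (MeasurableEquiv.toLp 2 (Fin 3 → ℝ)).symm.trans
    ((MeasurableEquiv.piFinSuccAbove (fun _ : Fin 3 => ℝ) 2).trans
      ((MeasurableEquiv.refl ℝ).prodCongr MeasurableEquiv.finTwoArrow))

lemma splitLast_apply (x : EuclideanSpace ℝ (Fin 3)) : splitLast x = (x 2, x 0, x 1) := rfl

lemma measurePreserving_splitLast : MeasurePreserving splitLast :=
  ((MeasurePreserving.id volume).prod (volume_preserving_finTwoArrow ℝ)).comp
    ((volume_preserving_piFinSuccAbove (fun _ : Fin 3 => ℝ) 2).comp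
      (EuclideanSpace.volume_preserving_symm_measurableEquiv_toLp (Fin 3)))

lemma setIntegral_domDd (T : ℝ) (g : ℝ × ℝ × ℝ → ℂ) :
    ∫ x in domDd T, g (x 2, x 0, x 1) =
      ∫ p, g p ∂((volume.restrict (Set.Icc (-T) T)).prod cellMeasure) := by
  have hdom : domDd T = splitLast ⁻¹'
      (Set.Icc (-T) T ×ˢ Set.Icc (-π) π ×ˢ Set.Icc (-π) π) := by
    ext x
    simp only [domDd, Set.mem_ofPred_eq, Set.mem_preimage, splitLast_apply, Set.mem_prod]
    tauto
  rw [cellMeasure, Measure.prod_restrict, Measure.prod_restrict, hdom]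
  exact measurePreserving_splitLast.setIntegral_preimage_emb
    splitLast.measurableEmbedding g _

/-- Integration by parts of a cut-off exponential. -/
lemma integral_cutoff_mul_exp {χ : ℝ → ℝ} (hχ : ContDiff ℝ 1 χ) {T : ℝ} (h0 : χ 0 = 1)
    (hT : χ T = 0) {z : ℂ} (hz : z ≠ 0) :
    ∫ t in (0 : ℝ)..T, (χ t : ℂ) * Complex.exp (Complex.I * z * (t : ℂ)) =
      -(1 / (Complex.I * z)) * (1 + ∫ t in (0 : ℝ)..T,
        Complex.exp (Complex.I * z * (t : ℂ)) * ((deriv χ t : ℝ) : ℂ)) := by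
  have hIz : Complex.I * z ≠ 0 := mul_ne_zero Complex.I_ne_zero hz
  have hu : ∀ t ∈ Set.uIcc 0 T, HasDerivAt (fun t : ℝ => (χ t : ℂ)) ((deriv χ t : ℝ) : ℂ) t :=
    fun t _ => (hχ.differentiable one_ne_zero t).hasDerivAt.ofReal_comp
  have hv : ∀ t ∈ Set.uIcc 0 T, HasDerivAt
      (fun t : ℝ => Complex.exp (Complex.I * z * (t : ℂ)) / (Complex.I * z))
      (Complex.exp (Complex.I * z * (t : ℂ))) t := by
    intro t _
    have := (((hasDerivAt_id (t : ℂ)).const_mul (Complex.I * z)).cexp.div_const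
      (Complex.I * z)).comp_ofReal
    simpa [hIz] using this
  rw [intervalIntegral.integral_mul_deriv_eq_deriv_mul hu hv
    ((Complex.continuous_ofReal.comp (hχ.continuous_deriv le_rfl)).intervalIntegrable _ _)
    ((by fun_prop : Continuous fun t : ℝ =>
      Complex.exp (Complex.I * z * (t : ℂ))).intervalIntegrable _ _)]
  simp_rw [mul_div_assoc', mul_comm ((deriv χ _ : ℝ) : ℂ), intervalIntegral.integral_div]
  simp only [h0, hT, Complex.ofReal_zero, Complex.ofReal_one, mul_zero, Complex.exp_zero]
  ring

/-- Folding the integral of a function of `|t|` against an exponential onto `[0, T]`. -/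
lemma setIntegral_Icc_abs_mul_exp {f : ℝ → ℂ} (hf : Continuous f) {T : ℝ} (hT : 0 ≤ T) (γ : ℂ) :
    ∫ t in Set.Icc (-T) T, f |t| * Complex.exp (-(Complex.I * γ * (t : ℂ))) =
      (∫ t in (0 : ℝ)..T, f t * Complex.exp (-(Complex.I * γ * (t : ℂ)))) +
        ∫ t in (0 : ℝ)..T, f t * Complex.exp (Complex.I * γ * (t : ℂ)) := by
  have hcont : Continuous fun t : ℝ => f |t| * Complex.exp (-(Complex.I * γ * (t : ℂ))) := by
    fun_prop
  rw [integral_Icc_eq_integral_Ioc, ← intervalIntegral.integral_of_le (by linarith),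
    ← intervalIntegral.integral_add_adjacent_intervals (b := 0)
      (hcont.intervalIntegrable _ _) (hcont.intervalIntegrable _ _), add_comm]
  congr 1
  · refine intervalIntegral.integral_congr fun t ht => ?_
    rw [Set.uIcc_of_le hT] at ht
    simp only [abs_of_nonneg ht.1]
  · have := intervalIntegral.integral_comp_neg (a := 0) (b := T)
      (fun t : ℝ => f |t| * Complex.exp (-(Complex.I * γ * (t : ℂ))))
    rw [neg_zero] at this
    rw [← this]
    refine intervalIntegral.integral_congr fun t ht => ?_
    rw [Set.uIcc_of_le hT] at ht
    simp [abs_of_nonneg ht.1]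

lemma funKd_mul_fBasis3 (k α₁ α₂ ct : ℝ) (𝒳 : ℝ → ℝ) (j : ℤ × ℤ × ℤ)
    (x : EuclideanSpace ℝ (Fin 3)) :
    funKd k α₁ α₂ 𝒳 x * fBasis3 ct (-j) x =
      (Complex.I / (8 * (π : ℂ) ^ 2) * (1 / (Real.sqrt (8 * π ^ 2 * ct) : ℂ))) *
        ((∑' n, greenMode k α₁ α₂ n (x 2) * planeWave n (x 0, x 1)) *
          (((𝒳 |x 2| : ℝ) : ℂ) *
            Complex.exp (-(Complex.I * ((j.2.2 : ℂ) * (π : ℂ) / (ct : ℂ)) * (x 2 : ℂ))) *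
            planeWave (-(j.1, j.2.1)) (x 0, x 1))) := by
  set A := Complex.exp (Complex.I * (α₁ : ℂ) * (x 0 : ℂ) + Complex.I * (α₂ : ℂ) * (x 1 : ℂ))
    with hA
  have hG : greenGd k α₁ α₂ x = Complex.I / (8 * (π : ℂ) ^ 2) *
      (A * ∑' n, greenMode k α₁ α₂ n (x 2) * planeWave n (x 0, x 1)) := by
    rw [greenGd, ← tsum_mul_left (a := A)]
    congr 1
    refine tsum_congr fun n => ?_
    rw [greenMode, planeWave, mul_assoc (1 / _), mul_left_comm A, hA, ← Complex.exp_add,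
      ← Complex.exp_add]
    push_cast
    ring_nf
  have hA' : Complex.exp (-Complex.I * (α₁ : ℂ) * (x 0 : ℂ) -
      Complex.I * (α₂ : ℂ) * (x 1 : ℂ)) * A = 1 := by
    rw [hA, ← Complex.exp_add]
    simp
  have hB : fBasis3 ct (-j) x = 1 / (Real.sqrt (8 * π ^ 2 * ct) : ℂ) *
      (Complex.exp (-(Complex.I * ((j.2.2 : ℂ) * (π : ℂ) / (ct : ℂ)) * (x 2 : ℂ))) *
        planeWave (-(j.1, j.2.1)) (x 0, x 1)) := by
    rw [fBasis3, planeWave, ← Complex.exp_add]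
    simp only [Prod.fst_neg, Prod.snd_neg]
    push_cast
    ring_nf
  rw [funKd, hG, hB]
  linear_combination (Complex.I / (8 * (π : ℂ) ^ 2) * (1 / (Real.sqrt (8 * π ^ 2 * ct) : ℂ))) *
    ((∑' n, greenMode k α₁ α₂ n (x 2) * planeWave n (x 0, x 1)) *
      (((𝒳 |x 2| : ℝ) : ℂ) *
        Complex.exp (-(Complex.I * ((j.2.2 : ℂ) * (π : ℂ) / (ct : ℂ)) * (x 2 : ℂ))) *
        planeWave (-(j.1, j.2.1)) (x 0, x 1))) * hA'

/-- Integration over the periodic variables reduces the Fourier coefficient of `funKd` to a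
one-dimensional integral. -/
lemma fourierCoef3_funKd_eq_integral {k α₁ α₂ ct : ℝ} (hk : 0 < k) (hct : 0 ≤ ct) {b : ℝ}
    (hb : 0 < b) (hβ : ∀ n : ℤ × ℤ, b ≤ ‖betaCoef3 k α₁ α₂ n‖) {𝒳 : ℝ → ℝ} (h𝒳 : Continuous 𝒳)
    {C : ℝ} (hC : ∀ t, |𝒳 t| ≤ C) (j : ℤ × ℤ × ℤ) :
    fourierCoef3 ct (funKd k α₁ α₂ 𝒳) j =
      Complex.I / 2 * (1 / (Real.sqrt (8 * π ^ 2 * ct) : ℂ)) *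
        ∫ t in Set.Icc (-ct) ct, (((𝒳 |t| : ℝ) : ℂ) *
          Complex.exp (-(Complex.I * ((j.2.2 : ℂ) * (π : ℂ) / (ct : ℂ)) * (t : ℂ)))) *
            greenMode k α₁ α₂ (j.1, j.2.1) t := by
  have hπ : (π : ℂ) ≠ 0 := Complex.ofReal_ne_zero.mpr pi_ne_zero
  have hsum : ∀ᵐ t ∂volume.restrict (Set.Icc (-ct) ct),
      Summable fun n => ‖greenMode k α₁ α₂ n t‖ :=
    (Measure.ae_ne _ 0).mono fun t ht => summable_norm_greenMode hk hb hβ ht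
  have hcont : Continuous fun t : ℝ => ((𝒳 |t| : ℝ) : ℂ) *
      Complex.exp (-(Complex.I * ((j.2.2 : ℂ) * (π : ℂ) / (ct : ℂ)) * (t : ℂ))) := by fun_prop
  have hbound : ∀ t : ℝ, ‖((𝒳 |t| : ℝ) : ℂ) *
      Complex.exp (-(Complex.I * ((j.2.2 : ℂ) * (π : ℂ) / (ct : ℂ)) * (t : ℂ)))‖ ≤ C := by
    intro t
    have : -(Complex.I * ((j.2.2 : ℂ) * (π : ℂ) / (ct : ℂ)) * (t : ℂ)) =
        ((-(j.2.2 * π / ct * t) : ℝ) : ℂ) * Complex.I := by push_cast; ring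
    rw [this, norm_mul, Complex.norm_exp_ofReal_mul_I, mul_one, Complex.norm_real]
    exact hC _
  have key := integral_prod_tsum_planeWave (fun n => (continuous_greenMode n).measurable) hsum
    (integrableOn_tsum_norm_sq_greenMode hk hb hβ hct) hcont.measurable hbound (j.1, j.2.1)
  rw [fourierCoef3]
  simp_rw [funKd_mul_fBasis3]
  rw [integral_const_mul, setIntegral_domDd ct fun p : ℝ × ℝ × ℝ =>
    (∑' n, greenMode k α₁ α₂ n p.1 * planeWave n p.2) * (((𝒳 |p.1| : ℝ) : ℂ) *
      Complex.exp (-(Complex.I * ((j.2.2 : ℂ) * (π : ℂ) / (ct : ℂ)) * (p.1 : ℂ))) *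
      planeWave (-(j.1, j.2.1)) p.2), key]
  field_simp
  norm_num

/-- If β_{j₁,j₂} ≠ ±j₃π/c̃ then
K̂_{dj} = (1/√(8π²c̃)) [1/((α₁+j₁)²+(α₂+j₂)²+(j₃π/c̃)²−k²)
 + (1/(2β_{j₁,j₂}(j₃π/c̃−β_{j₁,j₂}))) ∫₀^{c̃} e^{i(β_{j₁,j₂}−j₃π/c̃)x₃} 𝒳′(x₃) dx₃
 − (1/(2β_{j₁,j₂}(j₃π/c̃+β_{j₁,j₂}))) ∫₀^{c̃} e^{i(β_{j₁,j₂}+j₃π/c̃)x₃} 𝒳′(x₃) dx₃]. -/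
theorem statement12 (k α₁ α₂ c ct : ℝ) (hk : 0 < k) (hc : 0 < c) (hcct : c < ct)
    (b : ℝ) (hb : 0 < b) (hβ : ∀ n : ℤ × ℤ, b ≤ ‖betaCoef3 k α₁ α₂ n‖)
    (𝒳 : ℝ → ℝ) (h𝒳 : ContDiff ℝ (⊤ : ℕ∞) 𝒳)
    (h𝒳1 : ∀ t : ℝ, |t| ≤ c → 𝒳 t = 1)
    (h𝒳0 : ∀ t : ℝ, (c + ct) / 2 ≤ |t| → 𝒳 t = 0)
    (j : ℤ × ℤ × ℤ)
    (hj1 : betaCoef3 k α₁ α₂ (j.1, j.2.1) ≠ (j.2.2 : ℂ) * (π : ℂ) / (ct : ℂ))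
    (hj2 : betaCoef3 k α₁ α₂ (j.1, j.2.1) ≠ -((j.2.2 : ℂ) * (π : ℂ) / (ct : ℂ))) :
    fourierCoef3 ct (funKd k α₁ α₂ 𝒳) j =
      ((1 : ℂ) / (Real.sqrt (8 * π ^ 2 * ct) : ℂ)) *
        ((1 : ℂ) / (((α₁ + (j.1 : ℝ)) ^ 2 + (α₂ + (j.2.1 : ℝ)) ^ 2 +
            ((j.2.2 : ℝ) * π / ct) ^ 2 - k ^ 2 : ℝ) : ℂ) +
          (1 / (2 * betaCoef3 k α₁ α₂ (j.1, j.2.1) *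
              ((j.2.2 : ℂ) * (π : ℂ) / (ct : ℂ) - betaCoef3 k α₁ α₂ (j.1, j.2.1)))) *
            (∫ t in (0 : ℝ)..ct,
              Complex.exp (Complex.I *
                  (betaCoef3 k α₁ α₂ (j.1, j.2.1) - (j.2.2 : ℂ) * (π : ℂ) / (ct : ℂ)) * (t : ℂ)) *
                ((deriv 𝒳 t : ℝ) : ℂ)) -
          (1 / (2 * betaCoef3 k α₁ α₂ (j.1, j.2.1) *
              ((j.2.2 : ℂ) * (π : ℂ) / (ct : ℂ) + betaCoef3 k α₁ α₂ (j.1, j.2.1)))) *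
            (∫ t in (0 : ℝ)..ct,
              Complex.exp (Complex.I *
                  (betaCoef3 k α₁ α₂ (j.1, j.2.1) + (j.2.2 : ℂ) * (π : ℂ) / (ct : ℂ)) * (t : ℂ)) *
                ((deriv 𝒳 t : ℝ) : ℂ))) := by
  have hct : 0 < ct := hc.trans hcct
  have h0 : 𝒳 0 = 1 := h𝒳1 0 (by simpa using hc.le)
  have hT : 𝒳 ct = 0 := h𝒳0 ct (by rw [abs_of_pos hct]; linarith)
  have hχ : ContDiff ℝ 1 𝒳 := h𝒳.of_le (by exact_mod_cast le_top)
  obtain ⟨C, hC⟩ : ∃ C, ∀ t, |𝒳 t| ≤ C :=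
    (HasCompactSupport.intro (isCompact_closedBall (0 : ℝ) ct) fun t ht => h𝒳0 t (by
      rw [Metric.mem_closedBall, dist_zero_right, Real.norm_eq_abs, not_le] at ht
      linarith)).exists_bound_of_continuous hχ.continuous
  rw [fourierCoef3_funKd_eq_integral hk hct.le hb hβ hχ.continuous hC]
  set β := betaCoef3 k α₁ α₂ (j.1, j.2.1) with hβdef
  set γ : ℂ := (j.2.2 : ℂ) * (π : ℂ) / (ct : ℂ) with hγ
  have hβ0 : β ≠ 0 := norm_pos_iff.mp (hb.trans_le (hβ _))
  have hsub : γ - β ≠ 0 := sub_ne_zero.mpr hj1.symm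
  have hsub' : β - γ ≠ 0 := sub_ne_zero.mpr hj1
  have hadd : γ + β ≠ 0 := fun h => hj2 (eq_neg_of_add_eq_zero_right h)
  have hadd' : β + γ ≠ 0 := by rwa [add_comm]
  have hden : (((α₁ + (j.1 : ℝ)) ^ 2 + (α₂ + (j.2.1 : ℝ)) ^ 2 +
      ((j.2.2 : ℝ) * π / ct) ^ 2 - k ^ 2 : ℝ) : ℂ) = (γ - β) * (γ + β) := by
    have := betaCoef3_sq (k := k) (α₁ := α₁) (α₂ := α₂) (j.1, j.2.1)
    rw [← hβdef] at this
    push_cast at this ⊢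
    rw [← hγ]
    linear_combination this
  have hint : ∫ t in Set.Icc (-ct) ct, (((𝒳 |t| : ℝ) : ℂ) *
      Complex.exp (-(Complex.I * γ * (t : ℂ)))) * greenMode k α₁ α₂ (j.1, j.2.1) t =
      1 / β * ((∫ t in (0 : ℝ)..ct, (𝒳 t : ℂ) * Complex.exp (Complex.I * (β - γ) * (t : ℂ))) +
        ∫ t in (0 : ℝ)..ct, (𝒳 t : ℂ) * Complex.exp (Complex.I * (β + γ) * (t : ℂ))) := by
    have h1 := setIntegral_Icc_abs_mul_exp (f := fun t : ℝ => (𝒳 t : ℂ) *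
      Complex.exp (Complex.I * β * (t : ℂ)))
      ((Complex.continuous_ofReal.comp hχ.continuous).mul (by fun_prop)) hct.le γ
    simp_rw [mul_assoc ((𝒳 _ : ℝ) : ℂ), ← Complex.exp_add] at h1
    calc _ = ∫ t in Set.Icc (-ct) ct, 1 / β * (((𝒳 |t| : ℝ) : ℂ) *
          Complex.exp (Complex.I * β * ((|t| : ℝ) : ℂ) + -(Complex.I * γ * (t : ℂ)))) := by
          refine integral_congr_ae (.of_forall fun t => ?_)
          simp only [greenMode, Complex.exp_add]
          ring
      _ = _ := by
          rw [integral_const_mul, h1]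
          congr 4 <;> ext t <;> ring_nf
  rw [hint, integral_cutoff_mul_exp hχ h0 hT hsub', integral_cutoff_mul_exp hχ h0 hT hadd', hden]
  generalize (∫ t in (0 : ℝ)..ct, Complex.exp (Complex.I * (β - γ) * (t : ℂ)) *
    ((deriv 𝒳 t : ℝ) : ℂ)) = P
  generalize (∫ t in (0 : ℝ)..ct, Complex.exp (Complex.I * (β + γ) * (t : ℂ)) *
    ((deriv 𝒳 t : ℝ) : ℂ)) = Q
  have hmain : Complex.I / 2 * (1 / β * (-(1 / (Complex.I * (β - γ))) * (1 + P) +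
      -(1 / (Complex.I * (β + γ))) * (1 + Q))) =
      1 / ((γ - β) * (γ + β)) + 1 / (2 * β * (γ - β)) * P - 1 / (2 * β * (γ + β)) * Q := by
    have hI := Complex.I_ne_zero
    rw [← neg_sub γ β, add_comm β γ]
    field_simp
    ring
  rw [← hmain]
  ring

end
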